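/- If every finite simple group admits a minimal logarithmic signature, then every finite group admits a minimal logarithmic signature. -/

import Mathlib

/-- The product map of a sequence of blocks: `(a₁, …, aₛ) ↦ a₁ ⋯ aₛ`. -/
def lsProd {G : Type*} [Group G] {s : ℕ} (A : Fin s → Finset G)
    (a : ∀ i, (A i : Finset G)) : G :=
  (List.ofFn fun i => ((a i : G))).prod

/-- The length of a sequence of blocks: the sum of their cardinalities. -/
def lsLength {G : Type*} [Group G] {s : ℕ} (A : Fin s → Finset G) : ℕ :=
  ∑ i, (A i).card

/-- The minimal possible length `Σ aⱼ pⱼ` for a set of size `n = ∏ pⱼ^{aⱼ}`. -/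
def lsTarget (n : ℕ) : ℕ :=
  n.factorization.sum fun p a => a * p

/-- `A` is a logarithmic signature for the group `G`: the product map is a bijection. -/
def IsLS {G : Type*} [Group G] {s : ℕ} (A : Fin s → Finset G) : Prop :=
  Function.Bijective (lsProd A)

/-- `B` is a logarithmic signature for the finite subset `S` of `G`:
the product map is injective with image exactly `S`. -/
def IsLSFor {G : Type*} [Group G] (S : Finset G) {t : ℕ} (B : Fin t → Finset G) : Prop :=
  Function.Injective (lsProd B) ∧ ∀ g : G, g ∈ S ↔ ∃ b, lsProd B b = g

/-- The group `G` admits a minimal logarithmic signature. -/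
def HasMLS (G : Type*) [Group G] : Prop :=
  ∃ (s : ℕ) (A : Fin s → Finset G), IsLS A ∧ lsLength A = lsTarget (Nat.card G)

/-- The finite subset `S` of `G` admits a minimal logarithmic signature. -/
def HasMLSFor {G : Type*} [Group G] (S : Finset G) : Prop :=
  ∃ (t : ℕ) (B : Fin t → Finset G), IsLSFor S B ∧ lsLength B = lsTarget S.card

universe u

/-- A sequence of blocks is a logarithmic signature iff every group element has a unique
factorization along the blocks. -/
theorem isLS_iff_existsUnique {G : Type*} [Group G] {s : ℕ} (A : Fin s → Finset G) :
    IsLS A ↔ ∀ g : G, ∃! f : Fin s → G, (∀ i, f i ∈ A i) ∧ (List.ofFn f).prod = g := by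
  rw [IsLS, Function.bijective_iff_existsUnique]
  refine forall_congr' fun g => ⟨?_, ?_⟩
  · rintro ⟨a, ha, hu⟩
    refine ⟨fun i => a i, ⟨fun i => (a i).2, ha⟩, ?_⟩
    rintro f ⟨hf, hp⟩
    rw [← hu (fun i => ⟨f i, hf i⟩) hp]
  · rintro ⟨f, ⟨hf, hp⟩, hu⟩
    refine ⟨fun i => ⟨f i, hf i⟩, hp, fun a ha => ?_⟩
    funext i
    exact Subtype.ext (congrFun (hu (fun i => a i) ⟨fun i => (a i).2, ha⟩) i)

theorem lsTarget_mul {m n : ℕ} (hm : m ≠ 0) (hn : n ≠ 0) :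
    lsTarget (m * n) = lsTarget m + lsTarget n := by
  rw [lsTarget, Nat.factorization_mul hm hn]
  exact Finsupp.sum_add_index' (fun _ => zero_mul _) fun _ _ _ => add_mul _ _ _

theorem hasMLS_of_subsingleton (G : Type*) [Group G] [Subsingleton G] : HasMLS G := by
  refine ⟨0, Fin.elim0, ?_, ?_⟩
  · exact ⟨fun a b _ => Subsingleton.elim a b, fun g => ⟨fun i => i.elim0, Subsingleton.elim _ _⟩⟩
  · simp [lsLength, lsTarget]

/-- A logarithmic signature of a normal subgroup and one of the quotient, the latter lifted to
coset representatives, combine to one of the whole group. -/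
theorem IsLS.append_of_normal {G : Type*} [Group G] (N : Subgroup G) [N.Normal] {s t : ℕ}
    {A : Fin s → Finset (G ⧸ N)} {B : Fin t → Finset N} (hA : IsLS A) (hB : IsLS B) :
    IsLS (Fin.append (fun i => (A i).map ⟨Quotient.out, Quotient.out_injective⟩)
      (fun j => (B j).map ⟨Subtype.val, Subtype.val_injective⟩)) := by
  rw [isLS_iff_existsUnique] at hA hB ⊢
  have prod_mk {k : ℕ} (f : Fin k → G) :
      (((List.ofFn f).prod : G) : G ⧸ N) = (List.ofFn fun i => (f i : G ⧸ N)).prod := by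
    have := map_list_prod (QuotientGroup.mk' N) (List.ofFn f)
    rwa [List.map_ofFn] at this
  have prod_val {k : ℕ} (f : Fin k → N) :
      (((List.ofFn f).prod : N) : G) = (List.ofFn fun i => (f i : G)).prod := by
    have := map_list_prod N.subtype (List.ofFn f)
    rwa [List.map_ofFn] at this
  have prod_append (f : Fin s → G) (f' : Fin t → G) :
      (List.ofFn (Fin.append f f')).prod = (List.ofFn f).prod * (List.ofFn f').prod := by
    rw [List.ofFn_fin_append, List.prod_append]
  have mk_out (q : G ⧸ N) : ((Quotient.out q : G) : G ⧸ N) = q := QuotientGroup.out_eq' q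
  intro g
  obtain ⟨q, ⟨hq, hqp⟩, hqu⟩ := hA g
  have hn : (List.ofFn fun i => Quotient.out (q i)).prod⁻¹ * g ∈ N := by
    rw [← QuotientGroup.eq, prod_mk]
    simpa only [mk_out] using hqp
  obtain ⟨b, ⟨hb, hbp⟩, hbu⟩ := hB ⟨_, hn⟩
  refine ⟨Fin.append (fun i => Quotient.out (q i)) (fun j => (b j : G)), ⟨?_, ?_⟩, ?_⟩
  · intro i
    refine Fin.addCases (fun i => ?_) (fun j => ?_) i
    · rw [Fin.append_left, Fin.append_left]
      exact Finset.mem_map_of_mem _ (hq i)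
    · rw [Fin.append_right, Fin.append_right]
      exact Finset.mem_map_of_mem _ (hb j)
  · rw [prod_append, ← prod_val, hbp, mul_inv_cancel_left]
  · rintro f ⟨hf, hfp⟩
    have hl (i : Fin s) : ∃ x ∈ A i, Quotient.out x = f (Fin.castAdd t i) := by
      have := hf (Fin.castAdd t i)
      rwa [Fin.append_left, Finset.mem_map] at this
    have hr (j : Fin t) : ∃ x ∈ B j, (x : G) = f (Fin.natAdd s j) := by
      have := hf (Fin.natAdd s j)
      rwa [Fin.append_right, Finset.mem_map] at this
    choose q' hq' hq'f using hl
    choose b' hb' hb'f using hr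
    obtain rfl : f = Fin.append (fun i => Quotient.out (q' i)) (fun j => (b' j : G)) := by
      funext i
      refine Fin.addCases (fun i => ?_) (fun j => ?_) i
      · rw [Fin.append_left, hq'f]
      · rw [Fin.append_right, hb'f]
    rw [prod_append, ← prod_val] at hfp
    obtain rfl : q' = q := by
      refine hqu q' ⟨hq', ?_⟩
      rw [← hfp, QuotientGroup.mk_mul_of_mem _ (SetLike.coe_mem _), prod_mk]
      simp only [mk_out]
    obtain rfl : b' = b := hbu b' ⟨hb', Subtype.ext (eq_inv_mul_of_mul_eq hfp)⟩
    rfl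

theorem HasMLS.of_normal {G : Type*} [Group G] [Finite G] (N : Subgroup G) [N.Normal]
    (hN : HasMLS N) (hQ : HasMLS (G ⧸ N)) : HasMLS G := by
  obtain ⟨s, A, hA, hAl⟩ := hQ
  obtain ⟨t, B, hB, hBl⟩ := hN
  refine ⟨s + t, _, hA.append_of_normal N hB, ?_⟩
  rw [N.card_eq_card_quotient_mul_card_subgroup,
    lsTarget_mul Nat.card_pos.ne' Nat.card_pos.ne', ← hAl, ← hBl]
  simp [lsLength, Fin.sum_univ_add]

/-- if every finite simple group admits a minimal logarithmic signature,
then every finite group admits a minimal logarithmic signature. -/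
theorem hasMLS_of_simple_hasMLS
    (h : ∀ (S : Type u) [Group S] [Finite S] [IsSimpleGroup S], HasMLS S) :
    ∀ (G : Type u) [Group G] [Finite G], HasMLS G := by
  intro G _ _
  induction hn : Nat.card G using Nat.strong_induction_on generalizing G with
  | _ n ih =>
    subst hn
    cases subsingleton_or_nontrivial G
    · exact hasMLS_of_subsingleton G
    by_cases hG : IsSimpleGroup G
    · exact h G
    obtain ⟨N, hN, hbot, htop⟩ : ∃ N : Subgroup G, N.Normal ∧ N ≠ ⊥ ∧ N ≠ ⊤ := by
      by_contra! hc
      exact hG ⟨fun N hN => or_iff_not_imp_left.2 (hc N hN)⟩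
    have hcard := N.card_eq_card_quotient_mul_card_subgroup
    have hN1 : 1 < Nat.card N := N.one_lt_card_iff_ne_bot.2 hbot
    have hNG : Nat.card N < Nat.card G :=
      lt_of_le_of_ne N.card_le_card_group fun he => htop (N.eq_top_of_card_eq he)
    have hQG : Nat.card (G ⧸ N) < Nat.card G := by
      rw [hcard]
      exact lt_mul_of_one_lt_right Nat.card_pos hN1
    exact .of_normal N (ih _ hNG N rfl) (ih _ hQG (G ⧸ N) rfl)
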